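/- arXiv:1601.05138 — 2 statements merged into one kernel-verified Lean document; each statement's English description precedes it below -/
import Mathlib

section
/- For every multi-index ℓ ∈ ℕ⁴ there exists a constant C such that |D^ℓ(K*ρ_ε)(z)| ≤ C·(‖z‖ + ε)^{−3−|ℓ|} uniformly over all ε ∈ (0,1) and all space-time points z with ‖z‖ < 1. -/
open MeasureTheory

/-- The parabolic norm on space-time `ℝ×ℝ³` (coordinates `z 0 = t`, `z 1, z 2, z 3 = x`):
`‖z‖ = |t|^{1/2} + |x|`. -/
noncomputable def pnorm (z : Fin 4 → ℝ) : ℝ :=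
  Real.sqrt |z 0| + Real.sqrt ((z 1) ^ 2 + (z 2) ^ 2 + (z 3) ^ 2)

/-- The parabolic degree `|ℓ| = 2ℓ₀ + ℓ₁ + ℓ₂ + ℓ₃` of a multi-index. -/
def pdeg (l : Fin 4 → ℕ) : ℕ := 2 * l 0 + l 1 + l 2 + l 3

/-- Partial derivative in the `i`-th coordinate direction. -/
noncomputable def pd (i : Fin 4) (f : (Fin 4 → ℝ) → ℝ) : (Fin 4 → ℝ) → ℝ :=
  fun z => fderiv ℝ f z (Pi.single i 1)

/-- The multi-index derivative `D^ℓ = ∂_t^{ℓ₀}∂_{x₁}^{ℓ₁}∂_{x₂}^{ℓ₂}∂_{x₃}^{ℓ₃}`. -/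
noncomputable def Dmulti (l : Fin 4 → ℕ) (f : (Fin 4 → ℝ) → ℝ) : (Fin 4 → ℝ) → ℝ :=
  (pd 0)^[l 0] ((pd 1)^[l 1] ((pd 2)^[l 2] ((pd 3)^[l 3] f)))

/-- The parabolic rescaling `φ_ε(t,x) = ε⁻⁵ φ(t/ε², x/ε)`. -/
noncomputable def parRescale (ε : ℝ) (φ : (Fin 4 → ℝ) → ℝ) : (Fin 4 → ℝ) → ℝ :=
  fun z => (ε ^ 5)⁻¹ * φ (fun i => if i = 0 then z 0 / ε ^ 2 else z i / ε)

/-- Space-time convolution `(f*g)(z) = ∫ f(z−w)g(w) dw`. -/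
noncomputable def stConv (f g : (Fin 4 → ℝ) → ℝ) : (Fin 4 → ℝ) → ℝ :=
  fun z => ∫ w : Fin 4 → ℝ, f (z - w) * g w

open Filter Topology Set

section PartialDerivatives

lemma pd_eventuallyEq {i : Fin 4} {f g : (Fin 4 → ℝ) → ℝ} {z : Fin 4 → ℝ} (h : f =ᶠ[𝓝 z] g) :
    pd i f =ᶠ[𝓝 z] pd i g :=
  (h.fderiv (𝕜 := ℝ)).mono fun w hw => by simp only [pd, hw]

lemma iterate_pd_eventuallyEq {i : Fin 4} (n : ℕ) {f g : (Fin 4 → ℝ) → ℝ} {z : Fin 4 → ℝ}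
    (h : f =ᶠ[𝓝 z] g) : (pd i)^[n] f =ᶠ[𝓝 z] (pd i)^[n] g := by
  induction n generalizing f g with
  | zero => exact h
  | succ n ih => exact ih (pd_eventuallyEq h)

lemma Dmulti_eventuallyEq (l : Fin 4 → ℕ) {f g : (Fin 4 → ℝ) → ℝ} {z : Fin 4 → ℝ}
    (h : f =ᶠ[𝓝 z] g) : Dmulti l f =ᶠ[𝓝 z] Dmulti l g :=
  iterate_pd_eventuallyEq _ <| iterate_pd_eventuallyEq _ <| iterate_pd_eventuallyEq _ <|
    iterate_pd_eventuallyEq _ h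

lemma contDiff_pd (i : Fin 4) {f : (Fin 4 → ℝ) → ℝ} (hf : ContDiff ℝ (⊤ : ℕ∞) f) :
    ContDiff ℝ (⊤ : ℕ∞) (pd i f) :=
  (hf.fderiv_right (m := (⊤ : ℕ∞)) (by simp)).clm_apply contDiff_const

lemma contDiff_iterate_pd (i : Fin 4) (n : ℕ) {f : (Fin 4 → ℝ) → ℝ}
    (hf : ContDiff ℝ (⊤ : ℕ∞) f) : ContDiff ℝ (⊤ : ℕ∞) ((pd i)^[n] f) := by
  induction n generalizing f with
  | zero => exact hf
  | succ n ih => exact ih (contDiff_pd i hf)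

lemma contDiff_Dmulti (l : Fin 4 → ℕ) {f : (Fin 4 → ℝ) → ℝ} (hf : ContDiff ℝ (⊤ : ℕ∞) f) :
    ContDiff ℝ (⊤ : ℕ∞) (Dmulti l f) :=
  contDiff_iterate_pd _ _ <| contDiff_iterate_pd _ _ <| contDiff_iterate_pd _ _ <|
    contDiff_iterate_pd _ _ hf

lemma hasCompactSupport_iterate_pd (i : Fin 4) (n : ℕ) {f : (Fin 4 → ℝ) → ℝ}
    (hf : HasCompactSupport f) : HasCompactSupport ((pd i)^[n] f) := by
  induction n generalizing f with
  | zero => exact hf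
  | succ n ih => exact ih (hf.fderiv_apply (𝕜 := ℝ) (Pi.single i 1))

lemma hasCompactSupport_Dmulti (l : Fin 4 → ℕ) {f : (Fin 4 → ℝ) → ℝ}
    (hf : HasCompactSupport f) : HasCompactSupport (Dmulti l f) :=
  hasCompactSupport_iterate_pd _ _ <| hasCompactSupport_iterate_pd _ _ <|
    hasCompactSupport_iterate_pd _ _ <| hasCompactSupport_iterate_pd _ _ hf

lemma stConv_comm (f g : (Fin 4 → ℝ) → ℝ) : stConv f g = stConv g f := by
  funext z
  have h := integral_sub_left_eq_self (fun w => f (z - w) * g w) volume z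
  simp only [sub_sub_cancel] at h
  simp only [stConv, ← h, mul_comm (g _)]

lemma stConv_eq_convolution (f g : (Fin 4 → ℝ) → ℝ) :
    stConv f g = convolution g f (ContinuousLinearMap.mul ℝ ℝ) volume := by
  funext z
  simp [stConv, convolution, mul_comm]

lemma pd_stConv (i : Fin 4) {f g : (Fin 4 → ℝ) → ℝ} (hf : ContDiff ℝ (⊤ : ℕ∞) f)
    (hfc : HasCompactSupport f) (hg : LocallyIntegrable g) :
    pd i (stConv f g) = stConv (pd i f) g := by
  funext z
  rw [stConv_eq_convolution, stConv_eq_convolution, pd,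
    (hfc.hasFDerivAt_convolution_right _ hg (hf.of_le (by simp)) z).fderiv,
    convolution_precompR_apply _ hg (hfc.fderiv ℝ) (hf.continuous_fderiv (by simp))]
  rfl

lemma iterate_pd_stConv (i : Fin 4) (n : ℕ) {f g : (Fin 4 → ℝ) → ℝ}
    (hf : ContDiff ℝ (⊤ : ℕ∞) f) (hfc : HasCompactSupport f) (hg : LocallyIntegrable g) :
    (pd i)^[n] (stConv f g) = stConv ((pd i)^[n] f) g := by
  induction n generalizing f with
  | zero => rfl
  | succ n ih =>
    rw [Function.iterate_succ_apply, pd_stConv i hf hfc hg,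
      ih (contDiff_pd i hf) (hfc.fderiv_apply (𝕜 := ℝ) (Pi.single i 1))]
    rfl

lemma Dmulti_stConv (l : Fin 4 → ℕ) {f g : (Fin 4 → ℝ) → ℝ}
    (hf : ContDiff ℝ (⊤ : ℕ∞) f) (hfc : HasCompactSupport f) (hg : LocallyIntegrable g) :
    Dmulti l (stConv f g) = stConv (Dmulti l f) g := by
  have h3 := contDiff_iterate_pd 3 (l 3) hf
  have c3 := hasCompactSupport_iterate_pd 3 (l 3) hfc
  have h2 := contDiff_iterate_pd 2 (l 2) h3
  have c2 := hasCompactSupport_iterate_pd 2 (l 2) c3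
  rw [Dmulti, iterate_pd_stConv 3 _ hf hfc hg, iterate_pd_stConv 2 _ h3 c3 hg,
    iterate_pd_stConv 1 _ h2 c2 hg, iterate_pd_stConv 0 _ (contDiff_iterate_pd 1 (l 1) h2)
      (hasCompactSupport_iterate_pd 1 (l 1) c2) hg]
  rfl

/-- The parabolic contraction `(t, x) ↦ (t/ε², x/ε)` as a continuous linear map. -/
noncomputable def parContract (ε : ℝ) : (Fin 4 → ℝ) →L[ℝ] (Fin 4 → ℝ) :=
  ContinuousLinearMap.pi fun i =>
    (if i = 0 then (ε ^ 2)⁻¹ else ε⁻¹) • ContinuousLinearMap.proj (R := ℝ) (φ := fun _ => ℝ) i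

lemma parContract_apply (ε : ℝ) (z : Fin 4 → ℝ) (i : Fin 4) :
    parContract ε z i = (if i = 0 then (ε ^ 2)⁻¹ else ε⁻¹) * z i := by
  rw [parContract, ContinuousLinearMap.pi_apply]
  rfl

lemma parContract_single (ε : ℝ) (i : Fin 4) :
    parContract ε (Pi.single i 1) = (if i = 0 then (ε ^ 2)⁻¹ else ε⁻¹) • Pi.single i 1 := by
  funext j
  rw [parContract_apply]
  by_cases h : j = i
  · subst h; simp
  · simp [h]

lemma parRescale_eq (ε : ℝ) (φ : (Fin 4 → ℝ) → ℝ) :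
    parRescale ε φ = fun z => (ε ^ 5)⁻¹ * φ (parContract ε z) := by
  funext z
  unfold parRescale
  congr 2
  funext i
  rw [parContract_apply]
  by_cases h : i = 0
  · subst h; simp [div_eq_inv_mul]
  · simp [h, div_eq_inv_mul]

lemma pd_comp_parContract (ε c : ℝ) (i : Fin 4) {f : (Fin 4 → ℝ) → ℝ}
    (hf : ContDiff ℝ (⊤ : ℕ∞) f) :
    pd i (fun z => c * f (parContract ε z)) =
      fun z => (c * if i = 0 then (ε ^ 2)⁻¹ else ε⁻¹) * pd i f (parContract ε z) := by
  funext z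
  have h : HasFDerivAt (fun z => c * f (parContract ε z))
      (c • (fderiv ℝ f (parContract ε z)).comp (parContract ε)) z :=
    (((hf.differentiable (by simp)) _).hasFDerivAt.comp z
      (parContract ε).hasFDerivAt).const_mul c
  rw [pd, h.fderiv]
  simp only [FunLike.coe_smul, ContinuousLinearMap.coe_comp, Pi.smul_apply,
    Function.comp_apply, parContract_single, map_smul, smul_eq_mul, pd]
  ring

lemma iterate_pd_comp_parContract (ε c : ℝ) (i : Fin 4) (n : ℕ) {f : (Fin 4 → ℝ) → ℝ}
    (hf : ContDiff ℝ (⊤ : ℕ∞) f) :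
    (pd i)^[n] (fun z => c * f (parContract ε z)) =
      fun z => (c * (if i = 0 then (ε ^ 2)⁻¹ else ε⁻¹) ^ n) *
        (pd i)^[n] f (parContract ε z) := by
  induction n generalizing c f with
  | zero => simp
  | succ n ih =>
    rw [Function.iterate_succ_apply, pd_comp_parContract ε c i hf, ih _ (contDiff_pd i hf)]
    simp only [Function.iterate_succ_apply, pow_succ']
    simp only [mul_assoc]

lemma Dmulti_parRescale (ε : ℝ) (l : Fin 4 → ℕ) {f : (Fin 4 → ℝ) → ℝ}
    (hf : ContDiff ℝ (⊤ : ℕ∞) f) :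
    Dmulti l (parRescale ε f) =
      fun z => (ε ^ (5 + pdeg l))⁻¹ * Dmulti l f (parContract ε z) := by
  have h3 := contDiff_iterate_pd 3 (l 3) hf
  have h2 := contDiff_iterate_pd 2 (l 2) h3
  rw [parRescale_eq, Dmulti, iterate_pd_comp_parContract ε _ 3 _ hf,
    iterate_pd_comp_parContract ε _ 2 _ h3, iterate_pd_comp_parContract ε _ 1 _ h2,
    iterate_pd_comp_parContract ε _ 0 _ (contDiff_iterate_pd 1 (l 1) h2)]
  funext z
  simp only [Dmulti, pdeg]
  congr 1
  simp only [inv_pow, if_true, Fin.reduceEq, if_false, one_ne_zero]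
  rw [← mul_inv, ← mul_inv, ← mul_inv, ← mul_inv]
  congr 1
  ring

lemma contDiff_parRescale (ε : ℝ) {f : (Fin 4 → ℝ) → ℝ} (hf : ContDiff ℝ (⊤ : ℕ∞) f) :
    ContDiff ℝ (⊤ : ℕ∞) (parRescale ε f) := by
  rw [parRescale_eq]
  exact contDiff_const.mul (hf.comp (parContract ε).contDiff)

end PartialDerivatives

section ParabolicNorm

lemma continuous_pnorm : Continuous pnorm := by
  unfold pnorm
  fun_prop

lemma pnorm_nonneg (z : Fin 4 → ℝ) : 0 ≤ pnorm z := by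
  unfold pnorm
  positivity

@[simp] lemma pnorm_zero : pnorm 0 = 0 := by simp [pnorm]

lemma sqrt_abs_le_pnorm (z : Fin 4 → ℝ) : √|z 0| ≤ pnorm z := by
  unfold pnorm
  linarith [Real.sqrt_nonneg (z 1 ^ 2 + z 2 ^ 2 + z 3 ^ 2)]

lemma abs_zero_le_pnorm_sq (z : Fin 4 → ℝ) : |z 0| ≤ pnorm z ^ 2 := by
  have h := pow_le_pow_left₀ (Real.sqrt_nonneg _) (sqrt_abs_le_pnorm z) 2
  rwa [Real.sq_sqrt (abs_nonneg _)] at h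

lemma abs_le_pnorm (z : Fin 4 → ℝ) {i : Fin 4} (hi : i ≠ 0) : |z i| ≤ pnorm z := by
  have h : |z i| ≤ √(z 1 ^ 2 + z 2 ^ 2 + z 3 ^ 2) := by
    rw [← Real.sqrt_sq_eq_abs]
    apply Real.sqrt_le_sqrt
    fin_cases i <;> simp at hi ⊢ <;> nlinarith [sq_nonneg (z 1), sq_nonneg (z 2), sq_nonneg (z 3)]
  unfold pnorm
  linarith [Real.sqrt_nonneg |z 0|]

lemma pnorm_pos {z : Fin 4 → ℝ} (hz : z ≠ 0) : 0 < pnorm z := by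
  refine (pnorm_nonneg z).lt_of_ne' fun h => hz ?_
  funext i
  by_cases hi : i = 0
  · subst hi
    have := abs_zero_le_pnorm_sq z
    rw [h] at this
    exact abs_nonpos_iff.1 (by simpa using this)
  · have := abs_le_pnorm z hi
    rw [h] at this
    exact abs_nonpos_iff.1 this

lemma norm_le_pnorm_sq_add (z : Fin 4 → ℝ) : ‖z‖ ≤ pnorm z ^ 2 + pnorm z := by
  have hz := pnorm_nonneg z
  refine (pi_norm_le_iff_of_nonneg (by positivity)).2 fun i => ?_
  rw [Real.norm_eq_abs]
  by_cases hi : i = 0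
  · subst hi
    exact le_add_of_le_of_nonneg (abs_zero_le_pnorm_sq z) hz
  · exact le_add_of_nonneg_of_le (by positivity) (abs_le_pnorm z hi)

lemma hasCompactSupport_of_pnorm_le {f : (Fin 4 → ℝ) → ℝ} {r : ℝ}
    (hf : ∀ z, f z ≠ 0 → pnorm z ≤ r) : HasCompactSupport f := by
  refine HasCompactSupport.intro (isCompact_closedBall (0 : Fin 4 → ℝ) (r ^ 2 + r)) fun z hz => ?_
  by_contra h
  have hr := hf z h
  refine hz (mem_closedBall_zero_iff.2 ((norm_le_pnorm_sq_add z).trans ?_))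
  have := pnorm_nonneg z
  gcongr

lemma pnorm_add_le (z w : Fin 4 → ℝ) : pnorm (z + w) ≤ pnorm z + pnorm w := by
  have h0 : √|z 0 + w 0| ≤ √|z 0| + √|w 0| := by
    refine Real.sqrt_le_iff.2 ⟨by positivity, (abs_add_le _ _).trans ?_⟩
    rw [add_sq, Real.sq_sqrt (abs_nonneg _), Real.sq_sqrt (abs_nonneg _)]
    have : 0 ≤ 2 * √|z 0| * √|w 0| := by positivity
    linarith
  have h1 := norm_add_le (!₂[z 1, z 2, z 3]) (!₂[w 1, w 2, w 3])
  simp only [EuclideanSpace.norm_eq, Fin.sum_univ_three, Real.norm_eq_abs, sq_abs] at h1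
  simp at h1
  simp only [pnorm, Pi.add_apply]
  linarith

lemma pnorm_sub_comm (z w : Fin 4 → ℝ) : pnorm (z - w) = pnorm (w - z) := by
  simp only [pnorm, Pi.sub_apply, abs_sub_comm (z 0), sub_sq_comm (z _)]

lemma pnorm_parContract {ε : ℝ} (hε : 0 < ε) (z : Fin 4 → ℝ) :
    pnorm (parContract ε z) = pnorm z / ε := by
  simp only [pnorm, parContract_apply, if_true, Fin.reduceEq, if_false, one_ne_zero]
  have h1 : √|(ε ^ 2)⁻¹ * z 0| = √|z 0| / ε := by
    rw [abs_mul, abs_of_pos (by positivity), ← div_eq_inv_mul, Real.sqrt_div (abs_nonneg _),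
      Real.sqrt_sq hε.le]
  have h2 : √((ε⁻¹ * z 1) ^ 2 + (ε⁻¹ * z 2) ^ 2 + (ε⁻¹ * z 3) ^ 2) =
      √(z 1 ^ 2 + z 2 ^ 2 + z 3 ^ 2) / ε := by
    rw [← Real.sqrt_sq hε.le, ← Real.sqrt_div (by positivity), Real.sqrt_sq hε.le]
    congr 1
    field_simp
  rw [h1, h2, add_div]

lemma HasCompactSupport.exists_pnorm_le {f : (Fin 4 → ℝ) → ℝ} (hf : HasCompactSupport f) :
    ∃ R : ℝ, 0 < R ∧ ∀ z, f z ≠ 0 → pnorm z ≤ R := by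
  obtain ⟨R, hR⟩ := (hf.image continuous_pnorm).bddAbove
  refine ⟨max R 1, by positivity, fun z hz => le_max_of_le_left (hR ?_)⟩
  exact mem_image_of_mem _ (subset_tsupport f hz)

lemma pnorm_le_of_parRescale_ne_zero {ρ : (Fin 4 → ℝ) → ℝ} {R ε : ℝ} (hε : 0 < ε)
    (hρ : ∀ z, ρ z ≠ 0 → pnorm z ≤ R) {z : Fin 4 → ℝ} (hz : parRescale ε ρ z ≠ 0) :
    pnorm z ≤ R * ε := by
  rw [parRescale_eq] at hz
  have h := hρ _ (right_ne_zero_of_mul hz)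
  rwa [pnorm_parContract hε, div_le_iff₀ hε] at h

end ParabolicNorm

section SingularIntegrals

/-- The power `|s|^{-p}` cut off at `|s| ≤ r`. -/
noncomputable def truncPow (p r s : ℝ) : ℝ := (Iic r).indicator (fun s => s ^ (-p)) |s|

lemma truncPow_nonneg (p r s : ℝ) : 0 ≤ truncPow p r s :=
  indicator_apply_nonneg fun _ => Real.rpow_nonneg (abs_nonneg s) _

lemma truncPow_of_le {p r s : ℝ} (h : |s| ≤ r) : truncPow p r s = |s| ^ (-p) :=
  indicator_of_mem (s := Iic r) h _

lemma integral_truncPow {p r : ℝ} (hp : p < 1) (hr : 0 < r) :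
    ∫ s, truncPow p r s = 2 * (r ^ (1 - p) / (1 - p)) := by
  unfold truncPow
  rw [integral_comp_abs (f := (Iic r).indicator fun s => s ^ (-p)),
    setIntegral_indicator measurableSet_Iic, Ioi_inter_Iic, ← intervalIntegral.integral_of_le hr.le,
    integral_rpow (Or.inl (by linarith)), Real.zero_rpow (by linarith)]
  ring_nf

lemma integrable_truncPow {p r : ℝ} (hp : p < 1) (hr : 0 < r) : Integrable (truncPow p r) := by
  by_contra h
  have h1 := integral_undef h
  rw [integral_truncPow hp hr] at h1
  have : 0 < 1 - p := by linarith
  have : 0 < 2 * (r ^ (1 - p) / (1 - p)) := by positivity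
  linarith

/-- A product of truncated powers dominating parabolically homogeneous singularities on the
parabolic ball of radius `r`. -/
noncomputable def parMajorant (p q r : ℝ) (z : Fin 4 → ℝ) : ℝ :=
  ∏ i, (if i = 0 then truncPow p (r ^ 2) else truncPow q r) (z i)

lemma parMajorant_nonneg (p q r : ℝ) (z : Fin 4 → ℝ) : 0 ≤ parMajorant p q r z :=
  Finset.prod_nonneg fun i _ => by split_ifs <;> exact truncPow_nonneg _ _ _

lemma integrable_parMajorant {p q r : ℝ} (hp : p < 1) (hq : q < 1) (hr : 0 < r) :
    Integrable (parMajorant p q r) := by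
  refine Integrable.fintype_prod fun i => ?_
  split_ifs
  · exact integrable_truncPow hp (by positivity)
  · exact integrable_truncPow hq hr

lemma integral_parMajorant {p q r : ℝ} (hp : p < 1) (hq : q < 1) (hr : 0 < r) :
    ∫ z, parMajorant p q r z =
      2 * ((r ^ 2) ^ (1 - p) / (1 - p)) * (2 * (r ^ (1 - q) / (1 - q))) ^ 3 := by
  unfold parMajorant
  rw [integral_fintype_prod_volume_eq_prod
    (fun i : Fin 4 => if i = 0 then truncPow p (r ^ 2) else truncPow q r)]
  simp only [Fin.prod_univ_four, if_true, Fin.reduceEq, if_false, one_ne_zero]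
  rw [integral_truncPow hp (by positivity), integral_truncPow hq hr]
  ring

lemma integral_parMajorant_zero {r : ℝ} (hr : 0 < r) :
    ∫ z, parMajorant 0 0 r z = 16 * r ^ 5 := by
  rw [integral_parMajorant (by norm_num) (by norm_num) hr]
  simp
  ring

lemma integral_parMajorant_singular {r : ℝ} (hr : 0 < r) :
    ∫ z, parMajorant (3 / 4) (1 / 2) r z = 512 * r ^ 2 := by
  rw [integral_parMajorant (by norm_num) (by norm_num) hr, ← Real.rpow_natCast r 2,
    ← Real.rpow_mul hr.le]
  norm_num
  have h : (r ^ (1 / 2 : ℝ)) ^ 4 = r ^ 2 := by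
    rw [← Real.rpow_natCast, ← Real.rpow_mul hr.le, ← Real.rpow_natCast]
    norm_num
  linear_combination 512 * h

lemma parMajorant_zero_eq_one {r : ℝ} {z : Fin 4 → ℝ} (hz : pnorm z ≤ r) :
    parMajorant 0 0 r z = 1 := by
  refine Finset.prod_eq_one fun i _ => ?_
  split_ifs with h
  · subst h
    rw [truncPow_of_le ((abs_zero_le_pnorm_sq z).trans
      (pow_le_pow_left₀ (pnorm_nonneg z) hz 2))]
    simp
  · rw [truncPow_of_le ((abs_le_pnorm z h).trans hz)]
    simp

lemma pnorm_rpow_le_parMajorant {r : ℝ} {z : Fin 4 → ℝ} (h0 : ∀ i, z i ≠ 0) (hz : pnorm z ≤ r) :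
    pnorm z ^ (-(3 : ℝ)) ≤ parMajorant (3 / 4) (1 / 2) r z := by
  have hpos : 0 < pnorm z := pnorm_pos fun h => h0 0 (by simp [h])
  have ht : pnorm z ^ (-(3 / 2) : ℝ) ≤ truncPow (3 / 4) (r ^ 2) (z 0) := by
    have h := abs_zero_le_pnorm_sq z
    rw [truncPow_of_le (h.trans (pow_le_pow_left₀ (pnorm_nonneg z) hz 2))]
    refine le_trans (le_of_eq ?_)
      (Real.rpow_le_rpow_of_nonpos (abs_pos.2 (h0 0)) h (by norm_num : -(3 / 4 : ℝ) ≤ 0))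
    rw [← Real.rpow_natCast, ← Real.rpow_mul hpos.le]
    norm_num
  have hx : ∀ i : Fin 4, i ≠ 0 → pnorm z ^ (-(1 / 2) : ℝ) ≤ truncPow (1 / 2) r (z i) := by
    intro i hi
    have h := abs_le_pnorm z hi
    rw [truncPow_of_le (h.trans hz)]
    exact Real.rpow_le_rpow_of_nonpos (abs_pos.2 (h0 i)) h (by norm_num)
  have hsplit : pnorm z ^ (-(3 : ℝ)) = pnorm z ^ (-(3 / 2) : ℝ) * pnorm z ^ (-(1 / 2) : ℝ) *
      pnorm z ^ (-(1 / 2) : ℝ) * pnorm z ^ (-(1 / 2) : ℝ) := by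
    rw [← Real.rpow_add hpos, ← Real.rpow_add hpos, ← Real.rpow_add hpos]
    norm_num
  rw [hsplit, parMajorant]
  simp only [Fin.prod_univ_four, if_true, Fin.reduceEq, if_false, one_ne_zero]
  have h1 := hx 1 (by decide)
  have h2 := hx 2 (by decide)
  have h3 := hx 3 (by decide)
  have n0 := truncPow_nonneg (3 / 4) (r ^ 2) (z 0)
  have n1 := truncPow_nonneg (1 / 2) r (z 1)
  have n2 := truncPow_nonneg (1 / 2) r (z 2)
  gcongr

lemma ae_forall_coord_ne_zero : ∀ᵐ z : Fin 4 → ℝ, ∀ i, z i ≠ 0 :=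
  ae_all_iff.2 fun i => Measure.ae_eval_ne (μ := fun _ : Fin 4 => volume) i 0

end SingularIntegrals

section ConvolutionBounds

lemma inv_pow_le_of_le_mul {a x y : ℝ} (n : ℕ) (hx : 0 < x) (hy : 0 < y) (h : y ≤ a * x) :
    (x ^ n)⁻¹ ≤ a ^ n * (y ^ n)⁻¹ := by
  have h1 := pow_le_pow_left₀ hy.le h n
  rw [mul_pow] at h1
  rw [← div_eq_mul_inv, le_div_iff₀ (by positivity), inv_mul_le_iff₀ (by positivity)]
  linarith

lemma rpow_neg_three_sub {x : ℝ} (hx : 0 ≤ x) (d : ℕ) :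
    x ^ (-(3 : ℝ) - d) = (x ^ (3 + d))⁻¹ := by
  rw [← Real.rpow_natCast, ← Real.rpow_neg hx]
  congr 1
  push_cast
  ring

lemma integrable_of_le_pnorm_rpow {K : (Fin 4 → ℝ) → ℝ} {C r : ℝ} (hr : 0 < r)
    (hK : ContinuousOn K {(0 : Fin 4 → ℝ)}ᶜ) (hK_supp : ∀ z, r < pnorm z → K z = 0)
    (hK_bound : ∀ z, z ≠ 0 → |K z| ≤ C * pnorm z ^ (-(3 : ℝ))) : Integrable K := by
  refine ((integrable_parMajorant (p := 3 / 4) (q := 1 / 2) (by norm_num) (by norm_num)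
    hr).const_mul |C|).mono' ?_ ?_
  · have h := hK.aestronglyMeasurable (μ := volume) (measurableSet_singleton 0).compl
    rwa [restrict_compl_singleton] at h
  · filter_upwards [ae_forall_coord_ne_zero] with z hz
    rw [Real.norm_eq_abs]
    by_cases h : pnorm z ≤ r
    · refine (hK_bound z fun h0 => hz 0 (by simp [h0])).trans ?_
      gcongr
      · exact Real.rpow_nonneg (pnorm_nonneg z) _
      · exact le_abs_self C
      · exact pnorm_rpow_le_parMajorant hz h
    · rw [hK_supp z (not_le.1 h), abs_zero]
      exact mul_nonneg (abs_nonneg C) (parMajorant_nonneg _ _ _ _)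

/-- Inside the parabolic ball of radius `A * ε` all derivatives fall on the mollifier. -/
lemma exists_bound_Dmulti_stConv_near {ρ K : (Fin 4 → ℝ) → ℝ} {C : ℝ}
    (hρ : ContDiff ℝ (⊤ : ℕ∞) ρ) (hρc : HasCompactSupport ρ) (hK : LocallyIntegrable K)
    (hK_bound : ∀ z, z ≠ 0 → |K z| ≤ C * pnorm z ^ (-(3 : ℝ)))
    (l : Fin 4 → ℕ) {A : ℝ} (hA : 0 ≤ A) :
    ∃ B : ℝ, 0 ≤ B ∧ ∀ ε : ℝ, 0 < ε → ∀ z, pnorm z ≤ A * ε →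
      |Dmulti l (stConv K (parRescale ε ρ)) z| ≤ B * (ε ^ (3 + pdeg l))⁻¹ := by
  have hc := hasCompactSupport_Dmulti l hρc
  obtain ⟨Rρ, -, hρR⟩ := HasCompactSupport.exists_pnorm_le hρc
  obtain ⟨R, hR, hsupp⟩ := HasCompactSupport.exists_pnorm_le hc
  obtain ⟨M, hM⟩ := hc.exists_bound_of_continuous (contDiff_Dmulti l hρ).continuous
  have hM0 : 0 ≤ M := (norm_nonneg _).trans (hM 0)
  refine ⟨M * |C| * (512 * (A + R) ^ 2), by positivity, fun ε hε z hz => ?_⟩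
  have hscale : HasCompactSupport (parRescale ε ρ) := 
    hasCompactSupport_of_pnorm_le fun w => pnorm_le_of_parRescale_ne_zero hε hρR
  rw [stConv_comm, Dmulti_stConv l (contDiff_parRescale ε hρ) hscale hK, Dmulti_parRescale ε l hρ]
  have hr : 0 < (A + R) * ε := by positivity
  have hint := (integrable_parMajorant (p := 3 / 4) (q := 1 / 2) (by norm_num) (by norm_num)
    hr).const_mul ((ε ^ (5 + pdeg l))⁻¹ * M * |C|)
  refine (norm_integral_le_of_norm_le (G := ℝ) hint ?_).trans ?_
  · filter_upwards [ae_forall_coord_ne_zero] with w hw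
    have hw0 : w ≠ 0 := fun h0 => hw 0 (by simp [h0])
    by_cases h : Dmulti l ρ (parContract ε (z - w)) = 0
    · rw [h, mul_zero, zero_mul, norm_zero]
      have := parMajorant_nonneg (3 / 4) (1 / 2) ((A + R) * ε) w
      positivity
    · have h1 := hsupp _ h
      rw [pnorm_parContract hε, div_le_iff₀ hε] at h1
      have h2 := pnorm_add_le (w - z) z
      rw [sub_add_cancel, pnorm_sub_comm] at h2
      have h3 := pnorm_rpow_le_parMajorant hw (r := (A + R) * ε) (by linarith)
      have h4 : |K w| ≤ |C| * parMajorant (3 / 4) (1 / 2) ((A + R) * ε) w :=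
        (hK_bound w hw0).trans (mul_le_mul (le_abs_self C) h3
          (Real.rpow_nonneg (pnorm_nonneg w) _) (abs_nonneg C))
      rw [norm_mul, norm_mul, Real.norm_of_nonneg (by positivity), mul_assoc _ |C|]
      gcongr
      · exact hM _
      · exact h4
  · rw [integral_const_mul, integral_parMajorant_singular hr]
    apply le_of_eq
    rw [show 5 + pdeg l = 3 + pdeg l + 2 by ring, pow_add ε]
    field_simp

/-- Away from the support of the mollifier all derivatives fall on the kernel. -/
lemma exists_bound_Dmulti_stConv_far {ρ K : (Fin 4 → ℝ) → ℝ} {C R : ℝ} {l : Fin 4 → ℕ}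
    (hρ : Continuous ρ) (hρc : HasCompactSupport ρ) (hR : 0 < R)
    (hρ_supp : ∀ w, ρ w ≠ 0 → pnorm w ≤ R)
    (hK : ContDiffOn ℝ (⊤ : ℕ∞) K {(0 : Fin 4 → ℝ)}ᶜ)
    (hK_supp : ∀ z, 1 < pnorm z → K z = 0)
    (hK_bound : ∀ z, z ≠ 0 → |Dmulti l K z| ≤ C * (pnorm z ^ (3 + pdeg l))⁻¹) :
    ∃ B : ℝ, 0 ≤ B ∧ ∀ ε : ℝ, 0 < ε → ∀ z, 2 * R * ε ≤ pnorm z →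
      |Dmulti l (stConv K (parRescale ε ρ)) z| ≤ B * (pnorm z ^ (3 + pdeg l))⁻¹ := by
  obtain ⟨M, hM⟩ := hρc.exists_bound_of_continuous hρ
  have hM0 : 0 ≤ M := (norm_nonneg _).trans (hM 0)
  refine ⟨|C| * 2 ^ (3 + pdeg l) * M * (16 * R ^ 5), by positivity, fun ε hε z hz => ?_⟩
  have hRε : 0 < R * ε := by positivity
  have hzpos : 0 < pnorm z := by linarith
  have hρε_supp : ∀ w, parRescale ε ρ w ≠ 0 → pnorm w ≤ R * ε :=
    fun w => pnorm_le_of_parRescale_ne_zero hε hρ_supp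
  have hρε : Continuous (parRescale ε ρ) := by
    rw [parRescale_eq]
    exact continuous_const.mul (hρ.comp (parContract ε).continuous)
  obtain ⟨η, hη, hball⟩ := Metric.isOpen_iff.1
    (isOpen_lt continuous_pnorm (continuous_const (y := R * ε / 2))) 0
    (show pnorm 0 < R * ε / 2 by rw [pnorm_zero]; linarith)
  let χ : ContDiffBump (0 : Fin 4 → ℝ) := ⟨η / 2, η, by positivity, by linarith⟩
  set F : (Fin 4 → ℝ) → ℝ := fun w => (1 - χ w) * K w with hF
  have hFK : ∀ w, R * ε / 2 ≤ pnorm w → F w = K w := by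
    intro w hw
    have : χ w = 0 := χ.zero_of_le_dist <| by
      by_contra h
      exact absurd (hball (Metric.mem_ball.2 (not_le.1 h))) (not_lt.2 hw)
    simp [hF, this]
  have hF_smooth : ContDiff ℝ (⊤ : ℕ∞) F := by
    refine contDiff_iff_contDiffAt.2 fun w => ?_
    by_cases hw : w = 0
    · subst hw
      have : F =ᶠ[𝓝 0] fun _ => 0 := χ.eventuallyEq_one.mono fun w hw => by simp [hF, hw]
      exact contDiffAt_const.congr_of_eventuallyEq this
    · exact (contDiffAt_const.sub χ.contDiffAt).mul
        (hK.contDiffAt (isOpen_compl_singleton.mem_nhds hw))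
  have hF_supp : HasCompactSupport F := by
    refine hasCompactSupport_of_pnorm_le (r := 1) fun w hw => ?_
    by_contra h
    exact hw (by simp [hF, hK_supp w (not_le.1 h)])
  have hconv : stConv K (parRescale ε ρ) =ᶠ[𝓝 z] stConv F (parRescale ε ρ) := by
    filter_upwards [(isOpen_lt (continuous_const (y := 3 / 2 * (R * ε))) continuous_pnorm).mem_nhds
      (show 3 / 2 * (R * ε) < pnorm z by linarith)] with y hy
    have hy : 3 / 2 * (R * ε) < pnorm y := hy
    refine integral_congr_ae (Eventually.of_forall fun w => ?_)
    by_cases h : parRescale ε ρ w = 0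
    · simp [h]
    · have h1 := hρε_supp w h
      have h2 := pnorm_add_le (y - w) w
      rw [sub_add_cancel] at h2
      simp only [hFK (y - w) (by linarith)]
  rw [(Dmulti_eventuallyEq l hconv).eq_of_nhds,
    Dmulti_stConv l hF_smooth hF_supp hρε.locallyIntegrable]
  have hint := (integrable_parMajorant (p := 0) (q := 0) (by norm_num) (by norm_num)
    hRε).const_mul (|C| * (2 ^ (3 + pdeg l) * (pnorm z ^ (3 + pdeg l))⁻¹) * ((ε ^ 5)⁻¹ * M))
  refine (norm_integral_le_of_norm_le (G := ℝ) hint (Eventually.of_forall fun w => ?_)).trans ?_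
  · by_cases h : parRescale ε ρ w = 0
    · rw [h, mul_zero, norm_zero]
      have := parMajorant_nonneg 0 0 (R * ε) w
      positivity
    · have h1 := hρε_supp w h
      have h2 := pnorm_add_le (z - w) w
      rw [sub_add_cancel] at h2
      have hu : 0 < pnorm (z - w) := by linarith
      have hFu : Dmulti l F (z - w) = Dmulti l K (z - w) := by
        refine (Dmulti_eventuallyEq l ?_).eq_of_nhds
        filter_upwards [(isOpen_lt (continuous_const (y := R * ε / 2)) continuous_pnorm).mem_nhds
          (show R * ε / 2 < pnorm (z - w) by linarith)] with y hy
        exact hFK y (le_of_lt hy)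
      have h3 := hK_bound (z - w) fun h0 => by simp [h0] at hu
      rw [parMajorant_zero_eq_one h1, mul_one, norm_mul, hFu]
      refine mul_le_mul (h3.trans ?_) ?_ (norm_nonneg _) (by positivity)
      · gcongr
        · exact le_abs_self C
        · exact inv_pow_le_of_le_mul _ hu hzpos (by linarith)
      · rw [parRescale_eq, norm_mul, Real.norm_of_nonneg (by positivity)]
        gcongr
        exact hM _
  · rw [integral_const_mul, integral_parMajorant_zero hRε]
    apply le_of_eq
    field_simp

end ConvolutionBounds

/-- For every multi-index `ℓ` there is `C` with
`|D^ℓ(K*ρ_ε)(z)| ≤ C·(‖z‖ + ε)^{−3−|ℓ|}` uniformly over `ε ∈ (0,1)` and `‖z‖ < 1`. -/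
theorem stmt_8 (ρ K : (Fin 4 → ℝ) → ℝ)
    (hρ_smooth : ContDiff ℝ (⊤ : ℕ∞) ρ) (hρ_supp : HasCompactSupport ρ)
    (hρ_int : ∫ z, ρ z = 1)
    (hK_smooth : ContDiffOn ℝ (⊤ : ℕ∞) K {(0 : Fin 4 → ℝ)}ᶜ)
    (hK_supp : ∀ z, 1 < pnorm z → K z = 0)
    (hK_bound : ∀ l : Fin 4 → ℕ, ∃ C : ℝ, ∀ z : Fin 4 → ℝ, z ≠ 0 →
      |Dmulti l K z| ≤ C * pnorm z ^ (-(3 : ℝ) - pdeg l)) :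
    ∀ l : Fin 4 → ℕ, ∃ C : ℝ, ∀ ε : ℝ, 0 < ε → ε < 1 → ∀ z : Fin 4 → ℝ, pnorm z < 1 →
      |Dmulti l (stConv K (parRescale ε ρ)) z| ≤ C * (pnorm z + ε) ^ (-(3 : ℝ) - pdeg l) := by
  have hcast : ∀ (l : Fin 4 → ℕ) (x : ℝ), 0 ≤ x →
      x ^ (-(3 : ℝ) - pdeg l) = (x ^ (3 + pdeg l))⁻¹ := fun l x hx => rpow_neg_three_sub hx _
  obtain ⟨C₀, hC₀⟩ := hK_bound 0
  have hC₀' : ∀ z, z ≠ 0 → |K z| ≤ C₀ * pnorm z ^ (-(3 : ℝ)) := fun z hz => by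
    simpa [Dmulti, pdeg] using hC₀ z hz
  have hK_int := integrable_of_le_pnorm_rpow zero_lt_one hK_smooth.continuousOn hK_supp hC₀'
  obtain ⟨R, hR, hρR⟩ := HasCompactSupport.exists_pnorm_le hρ_supp
  intro l
  obtain ⟨C, hC⟩ := hK_bound l
  obtain ⟨B₁, hB₁, hnear⟩ := exists_bound_Dmulti_stConv_near hρ_smooth hρ_supp
    hK_int.locallyIntegrable hC₀' l (A := 2 * R) (by positivity)
  obtain ⟨B₂, hB₂, hfar⟩ := exists_bound_Dmulti_stConv_far hρ_smooth.continuous hρ_supp hR hρR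
    hK_smooth hK_supp fun z hz => (hC z hz).trans_eq (by rw [hcast l _ (pnorm_nonneg z)])
  refine ⟨B₁ * (2 * R + 1) ^ (3 + pdeg l) + B₂ * (1 + 1 / (2 * R)) ^ (3 + pdeg l),
    fun ε hε _ z _ => ?_⟩
  have hz := pnorm_nonneg z
  have hpos : 0 < pnorm z + ε := by positivity
  rw [hcast l _ hpos.le, add_mul]
  rcases le_total (pnorm z) (2 * R * ε) with h | h
  · have h1 := inv_pow_le_of_le_mul (a := 2 * R + 1) (3 + pdeg l) hε hpos (by linarith)
    refine (hnear ε hε z h).trans (le_add_of_le_of_nonneg ?_ (by positivity))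
    rw [mul_assoc]
    gcongr
  · have hzpos : 0 < pnorm z := lt_of_lt_of_le (by positivity) h
    have hε' : ε ≤ pnorm z / (2 * R) := by
      rw [le_div_iff₀ (by positivity)]
      linarith
    have h1 := inv_pow_le_of_le_mul (a := 1 + 1 / (2 * R)) (3 + pdeg l) hzpos hpos (by
      rw [add_mul, one_mul, one_div_mul_eq_div]
      linarith)
    refine (hfar ε hε z h).trans (le_add_of_nonneg_of_le (by positivity) ?_)
    rw [mul_assoc]
    gcongr
end

section
/- Let ρ : ℝ×ℝ³ → ℝ be smooth and compactly supported with ∫ρ dz = 1, and ρ_ε(t,x) = ε^{−5}ρ(t/ε², x/ε). Let K : ℝ×ℝ³ → ℝ be measurable and compactly supported with K(z) = P(z) for all z with 0 < ‖z‖ ≤ 1/2, and K bounded on {z : ‖z‖ ≥ 1/2}. Then ε·∫_{ℝ×ℝ³}(K*ρ_ε)²(z) dz → C₀ as ε → 0, where C₀ = ∫_{ℝ×ℝ³}((P*ρ)(z))² dz is finite. Equivalently, the renormalisation constant C₁^{(ε)} = ∫K_ε² dz satisfies C₁^{(ε)} = C₀/ε + O(1). -/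
open MeasureTheory

/-- The heat kernel on `ℝ³`, as a function on space-time `ℝ×ℝ³`. -/
noncomputable def heatP (z : Fin 4 → ℝ) : ℝ :=
  if 0 < z 0 then
    (4 * Real.pi * z 0) ^ (-(3 : ℝ) / 2) *
      Real.exp (-((z 1) ^ 2 + (z 2) ^ 2 + (z 3) ^ 2) / (4 * z 0))
  else 0

open Filter Topology Set

lemma intervalIntegrable_abs_rpow {r : ℝ} (hr : -1 < r) (a b : ℝ) :
    IntervalIntegrable (fun v : ℝ => |v| ^ r) volume a b := by
  have pos : ∀ c : ℝ, 0 ≤ c → IntervalIntegrable (fun v : ℝ => |v| ^ r) volume 0 c := by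
    intro c hc
    refine (intervalIntegral.intervalIntegrable_rpow' (a := 0) (b := c) hr).congr ?_
    intro v hv
    rw [uIoc_of_le hc] at hv
    simp only [abs_of_pos hv.1]
  have all : ∀ c : ℝ, IntervalIntegrable (fun v : ℝ => |v| ^ r) volume 0 c := by
    intro c
    rcases le_total 0 c with hc | hc
    · exact pos c hc
    · rw [IntervalIntegrable.iff_comp_neg]
      simpa using pos (-c) (by linarith)
  exact (all a).symm.trans (all b)

/-- The one-dimensional singular profile `u ↦ |s - u|^{-3/5}`, cut off to `[-R, R]`. -/
noncomputable def cutProfile (R s : ℝ) : ℝ → ℝ :=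
  (Icc (-R) R).indicator fun u => |s - u| ^ (-(3 / 5) : ℝ)

lemma cutProfile_nonneg (R s u : ℝ) : 0 ≤ cutProfile R s u :=
  indicator_nonneg (fun _ _ => by positivity) u

lemma integrable_cutProfile {R : ℝ} (hR : 1 ≤ R) (s : ℝ) : Integrable (cutProfile R s) := by
  unfold cutProfile
  rw [integrable_indicator_iff measurableSet_Icc, integrableOn_Icc_iff_integrableOn_Ioc,
    ← intervalIntegrable_iff_integrableOn_Ioc_of_le (by linarith)]
  have h := (intervalIntegrable_abs_rpow (r := -(3 / 5)) (by norm_num)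
    (s - -R) (s - R)).comp_sub_left s (by simp)
  simpa using h

lemma exists_integral_cutProfile_le {R : ℝ} (hR : 1 ≤ R) :
    ∃ B : ℝ, ∀ s, ∫ u, cutProfile R s u ≤ B * (1 + |s|) ^ (-(3 / 5) : ℝ) := by
  set I : ℝ := ∫ v in (-(3 * R))..(3 * R), |v| ^ (-(3 / 5) : ℝ) with hI
  have hI0 : 0 ≤ I := intervalIntegral.integral_nonneg (by linarith) fun _ _ => by positivity
  refine ⟨I * (1 + 2 * R) ^ (3 / 5 : ℝ) + 2 * R * 4 ^ (3 / 5 : ℝ), fun s => ?_⟩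
  have hs0 : 0 < 1 + |s| := by positivity
  rw [add_mul]
  rcases lt_or_ge |s| (2 * R) with hs | hs
  · have h1 : ∫ u, cutProfile R s u = ∫ v in (s - R)..(s - -R), |v| ^ (-(3 / 5) : ℝ) := by
      unfold cutProfile
      rw [integral_indicator measurableSet_Icc, integral_Icc_eq_integral_Ioc,
        ← intervalIntegral.integral_of_le (by linarith),
        intervalIntegral.integral_comp_sub_left (fun v => |v| ^ (-(3 / 5) : ℝ))]
    have h2 : ∫ v in (s - R)..(s - -R), |v| ^ (-(3 / 5) : ℝ) ≤ I := by
      obtain ⟨h3, h4⟩ := abs_lt.1 hs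
      refine intervalIntegral.integral_mono_interval (by linarith) (by linarith) (by linarith)
        (ae_of_all _ fun _ => by positivity) ?_
      exact intervalIntegrable_abs_rpow (by norm_num) _ _
    have h3 : 1 ≤ (1 + 2 * R) ^ (3 / 5 : ℝ) * (1 + |s|) ^ (-(3 / 5) : ℝ) := by
      rw [Real.rpow_neg hs0.le, ← div_eq_mul_inv, one_le_div (by positivity)]
      exact Real.rpow_le_rpow hs0.le (by linarith) (by norm_num)
    have h4 : 0 ≤ 2 * R * 4 ^ (3 / 5 : ℝ) * (1 + |s|) ^ (-(3 / 5) : ℝ) := by positivity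
    rw [h1]
    nlinarith [mul_le_mul_of_nonneg_left h3 hI0]
  · have h1 : ∫ u, cutProfile R s u ≤
        ∫ u, (Icc (-R) R).indicator (fun _ => ((1 + |s|) / 4) ^ (-(3 / 5) : ℝ)) u := by
      refine integral_mono (integrable_cutProfile hR s) ?_ fun u => ?_
      · rw [integrable_indicator_iff measurableSet_Icc]
        exact integrableOn_const (by simp)
      · refine indicator_le_indicator' fun hu => ?_
        have h3 : |u| ≤ R := abs_le.2 hu
        have h4 := abs_sub_abs_le_abs_sub s u
        exact Real.rpow_le_rpow_of_nonpos (by positivity) (by linarith) (by norm_num)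
    rw [integral_indicator measurableSet_Icc, setIntegral_const] at h1
    have h2 : ((1 + |s|) / 4) ^ (-(3 / 5) : ℝ) = 4 ^ (3 / 5 : ℝ) * (1 + |s|) ^ (-(3 / 5) : ℝ) := by
      rw [Real.div_rpow hs0.le (by norm_num), Real.rpow_neg (by norm_num : (0 : ℝ) ≤ 4)]
      field_simp
    have h3 : 0 ≤ I * (1 + 2 * R) ^ (3 / 5 : ℝ) * (1 + |s|) ^ (-(3 / 5) : ℝ) := by positivity
    rw [h2, Real.volume_real_Icc_of_le (by linarith), smul_eq_mul] at h1
    linarith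

lemma exists_abs_le_cutoff {ρ : (Fin 4 → ℝ) → ℝ} (hc : Continuous ρ) (hs : HasCompactSupport ρ) :
    ∃ A R : ℝ, 1 ≤ R ∧ (∀ v, |ρ v| ≤ A) ∧ ∀ v, (∃ i, v i ∉ Icc (-R) R) → ρ v = 0 := by
  obtain ⟨A, hA⟩ := hs.exists_bound_of_continuous hc
  obtain ⟨R, hR⟩ := hs.isCompact.isBounded.exists_norm_le
  refine ⟨A, max R 1, le_max_right _ _, hA, ?_⟩
  rintro v ⟨i, hi⟩
  by_contra h
  have h1 := hR v (subset_tsupport _ h)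
  exact hi (abs_le.1 (((norm_le_pi_norm v i).trans h1).trans (le_max_left _ _)))

lemma ae_forall_apply_ne (z : Fin 4 → ℝ) : ∀ᵐ v : Fin 4 → ℝ, ∀ i, (z - v) i ≠ 0 := by
  rw [ae_all_iff]
  intro i
  have h : ∀ᵐ v : Fin 4 → ℝ, v i ≠ z i := by
    rw [volume_pi]
    exact Measure.ae_eval_ne (fun _ : Fin 4 => (volume : Measure ℝ)) i (z i)
  filter_upwards [h] with v hv
  simpa [sub_eq_zero] using hv.symm

/-- The kernel bound `|f(z)| ≤ C ∏ |z i|^{-3/5}` off the coordinate hyperplanes. -/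
def HasHyperbolicBound (C : ℝ) (f : (Fin 4 → ℝ) → ℝ) : Prop :=
  ∀ z : Fin 4 → ℝ, (∀ i, z i ≠ 0) → |f z| ≤ C * ∏ i, |z i| ^ (-(3 / 5) : ℝ)

lemma HasHyperbolicBound.ae_norm_mul_le {C A R : ℝ} {f ρ : (Fin 4 → ℝ) → ℝ}
    (hf : HasHyperbolicBound C f) (hA : ∀ v, |ρ v| ≤ A)
    (hR : ∀ v, (∃ i, v i ∉ Icc (-R) R) → ρ v = 0) (z : Fin 4 → ℝ) :
    ∀ᵐ v : Fin 4 → ℝ, ‖f (z - v) * ρ v‖ ≤ C * A * ∏ i, cutProfile R (z i) (v i) := by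
  filter_upwards [ae_forall_apply_ne z] with v hv
  rw [norm_mul, Real.norm_eq_abs, Real.norm_eq_abs]
  by_cases h : ∀ i, v i ∈ Icc (-R) R
  · have h1 : ∏ i, cutProfile R (z i) (v i) = ∏ i, |(z - v) i| ^ (-(3 / 5) : ℝ) :=
      Finset.prod_congr rfl fun i _ => by simp [cutProfile, indicator_of_mem (h i)]
    rw [h1, mul_right_comm]
    exact mul_le_mul (hf _ hv) (hA v) (abs_nonneg _) ((abs_nonneg _).trans (hf _ hv))
  · push Not at h
    obtain ⟨i, hi⟩ := h
    rw [hR v ⟨i, hi⟩, Finset.prod_eq_zero (Finset.mem_univ i) (by simp [cutProfile, hi])]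
    simp

lemma integrable_prod_cutProfile {R : ℝ} (hR : 1 ≤ R) (z : Fin 4 → ℝ) :
    Integrable fun v : Fin 4 → ℝ => ∏ i, cutProfile R (z i) (v i) :=
  Integrable.fintype_prod fun i => integrable_cutProfile hR (z i)

/-- Convolution of a kernel satisfying the hyperbolic bound with a bounded compactly supported
function decays like `∏ (1 + |z i|)^{-3/5}`. -/
lemma HasHyperbolicBound.abs_stConv_le {C A R B : ℝ} {f ρ : (Fin 4 → ℝ) → ℝ}
    (hf : HasHyperbolicBound C f) (hC : 0 ≤ C) (hA : ∀ v, |ρ v| ≤ A) (hR1 : 1 ≤ R)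
    (hR : ∀ v, (∃ i, v i ∉ Icc (-R) R) → ρ v = 0)
    (hB : ∀ s, ∫ u, cutProfile R s u ≤ B * (1 + |s|) ^ (-(3 / 5) : ℝ)) (z : Fin 4 → ℝ) :
    |stConv f ρ z| ≤ C * A * ∏ i, B * (1 + |z i|) ^ (-(3 / 5) : ℝ) := by
  have hA0 : 0 ≤ A := (abs_nonneg _).trans (hA 0)
  have h1 := norm_integral_le_of_norm_le ((integrable_prod_cutProfile hR1 z).const_mul (C * A))
    (hf.ae_norm_mul_le hA hR z)
  rw [integral_const_mul, integral_fintype_prod_volume_eq_prod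
    (f := fun i => cutProfile R (z i))] at h1
  refine h1.trans (mul_le_mul_of_nonneg_left ?_ (by positivity))
  exact Finset.prod_le_prod (fun i _ => integral_nonneg (cutProfile_nonneg _ _)) fun i _ => hB _

lemma integrable_sq_prod_one_add_abs (C B : ℝ) :
    Integrable fun z : Fin 4 → ℝ => (C * ∏ i, B * (1 + |z i|) ^ (-(3 / 5) : ℝ)) ^ 2 := by
  have h : Integrable fun s : ℝ => (1 + ‖s‖) ^ (-(6 / 5) : ℝ) :=
    integrable_one_add_norm (by norm_num)
  have h2 := (Integrable.fintype_prod (ι := Fin 4) (μ := fun _ => volume)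
    fun _ => h.const_mul (B ^ 2)).const_mul (C ^ 2)
  refine h2.congr (ae_of_all _ fun z => ?_)
  simp only [mul_pow, ← Finset.prod_pow]
  congr 1
  refine Finset.prod_congr rfl fun i _ => ?_
  rw [← Real.rpow_natCast _ 2, ← Real.rpow_natCast (_ ^ _) 2, ← Real.rpow_mul (by positivity)]
  norm_num

lemma measurable_stConv {f ρ : (Fin 4 → ℝ) → ℝ} (hf : Measurable f) (hρ : Measurable ρ) :
    Measurable (stConv f ρ) := by
  have h : Measurable fun p : (Fin 4 → ℝ) × (Fin 4 → ℝ) => f (p.1 - p.2) * ρ p.2 := by fun_prop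
  exact h.stronglyMeasurable.integral_prod_right'.measurable

lemma measurable_heatP : Measurable heatP := by
  unfold heatP
  exact Measurable.ite (measurableSet_lt measurable_const (measurable_pi_apply 0))
    (by fun_prop) measurable_const

lemma rpow_mul_exp_le {t x : ℝ} (ht : 0 < t) (hx : x ≠ 0) :
    t ^ (-(3 / 10) : ℝ) * Real.exp (-(x ^ 2) / (4 * t)) ≤ 4 * |x| ^ (-(3 / 5) : ℝ) := by
  have hx0 : 0 < |x| := abs_pos.2 hx
  set y : ℝ := x ^ 2 / t with hy
  have hy0 : 0 < y := by positivity
  have h1 : y ^ (3 / 10 : ℝ) = |x| ^ (3 / 5 : ℝ) * t ^ (-(3 / 10) : ℝ) := by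
    rw [hy, Real.div_rpow (by positivity) ht.le, ← sq_abs, ← Real.rpow_natCast,
      ← Real.rpow_mul hx0.le, Real.rpow_neg ht.le, div_eq_mul_inv]
    norm_num
  have h2 : y ^ (3 / 10 : ℝ) ≤ 1 + y := by
    calc y ^ (3 / 10 : ℝ) ≤ (1 + y) ^ (3 / 10 : ℝ) :=
          Real.rpow_le_rpow hy0.le (by linarith) (by norm_num)
      _ ≤ (1 + y) ^ (1 : ℝ) := Real.rpow_le_rpow_of_exponent_le (by linarith) (by norm_num)
      _ = 1 + y := Real.rpow_one _
  have h3 : 1 + y ≤ 4 * Real.exp (y / 4) := by linarith [Real.add_one_le_exp (y / 4)]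
  have h4 : Real.exp (-(x ^ 2) / (4 * t)) = (Real.exp (y / 4))⁻¹ := by
    rw [← Real.exp_neg]; congr 1; rw [hy]; field_simp
  rw [h4, Real.rpow_neg hx0.le, ← div_eq_mul_inv, ← div_eq_mul_inv,
    div_le_div_iff₀ (Real.exp_pos _) (by positivity), mul_comm]
  linarith

lemma hasHyperbolicBound_heatP : HasHyperbolicBound 64 heatP := by
  intro z hz
  unfold heatP
  split_ifs with ht
  · rw [abs_of_nonneg (by positivity)]
    set t := z 0 with h_t
    have h1 := rpow_mul_exp_le ht (hz 1)
    have h2 := rpow_mul_exp_le ht (hz 2)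
    have h3 := rpow_mul_exp_le ht (hz 3)
    have e0 : (4 * Real.pi * t) ^ (-(3 : ℝ) / 2) ≤ t ^ (-(3 : ℝ) / 2) :=
      Real.rpow_le_rpow_of_nonpos ht (by nlinarith [Real.pi_gt_three]) (by norm_num)
    have e1 : t ^ (-(3 : ℝ) / 2) = t ^ (-(3 / 5) : ℝ) *
        (t ^ (-(3 / 10) : ℝ) * t ^ (-(3 / 10) : ℝ) * t ^ (-(3 / 10) : ℝ)) := by
      rw [← Real.rpow_add ht, ← Real.rpow_add ht, ← Real.rpow_add ht]; norm_num
    have e2 : Real.exp (-((z 1) ^ 2 + (z 2) ^ 2 + (z 3) ^ 2) / (4 * t)) =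
        Real.exp (-(z 1 ^ 2) / (4 * t)) * Real.exp (-(z 2 ^ 2) / (4 * t)) *
          Real.exp (-(z 3 ^ 2) / (4 * t)) := by
      rw [← Real.exp_add, ← Real.exp_add]; congr 1; ring
    refine (mul_le_mul_of_nonneg_right e0 (Real.exp_pos _).le).trans ?_
    rw [e1, e2, Fin.prod_univ_four, ← h_t, abs_of_pos ht]
    have h12 := mul_le_mul h1 h2 (by positivity) (by positivity)
    have h123 := mul_le_mul h12 h3 (by positivity) (by positivity)
    have h := mul_le_mul_of_nonneg_left h123 (Real.rpow_nonneg ht.le (-(3 / 5)))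
    calc _ = _ := by ring
      _ ≤ _ := h
      _ = _ := by ring
  · rw [abs_zero]; positivity

lemma pnorm_pos_of_apply_zero_ne {z : Fin 4 → ℝ} (hz : z 0 ≠ 0) : 0 < pnorm z := by
  unfold pnorm
  have := Real.sqrt_pos.2 (abs_pos.2 hz)
  positivity

lemma exists_hasHyperbolicBound {K : (Fin 4 → ℝ) → ℝ} (hK_supp : HasCompactSupport K)
    (hK_eq : ∀ z : Fin 4 → ℝ, 0 < pnorm z → pnorm z ≤ 1 / 2 → K z = heatP z)
    (hK_bdd : ∃ M : ℝ, ∀ z : Fin 4 → ℝ, 1 / 2 ≤ pnorm z → |K z| ≤ M) :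
    ∃ C, 0 ≤ C ∧ HasHyperbolicBound C K := by
  obtain ⟨M, hM⟩ := hK_bdd
  obtain ⟨R, hR⟩ := hK_supp.isCompact.isBounded.exists_norm_le
  have hR0 : 0 < max R 1 := by positivity
  set L : ℝ := ∏ _i : Fin 4, (max R 1) ^ (-(3 / 5) : ℝ) with hL
  have hL0 : 0 < L := by positivity
  refine ⟨64 + |M| / L, by positivity, fun z hz => ?_⟩
  rw [add_mul]
  have hp : 0 ≤ ∏ i, |z i| ^ (-(3 / 5) : ℝ) := by positivity
  rcases le_total (pnorm z) (1 / 2) with h | h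
  · rw [hK_eq z (pnorm_pos_of_apply_zero_ne (hz 0)) h]
    have := hasHyperbolicBound_heatP z hz
    have : 0 ≤ |M| / L * ∏ i, |z i| ^ (-(3 / 5) : ℝ) := by positivity
    linarith
  · by_cases h0 : K z = 0
    · rw [h0, abs_zero]; positivity
    · have hz1 : ∀ i, |z i| ≤ max R 1 := fun i =>
        ((norm_le_pi_norm z i).trans (hR z (subset_tsupport _ h0))).trans (le_max_left _ _)
      have h1 : L ≤ ∏ i, |z i| ^ (-(3 / 5) : ℝ) := Finset.prod_le_prod (fun _ _ => by positivity)
        fun i _ => Real.rpow_le_rpow_of_nonpos (abs_pos.2 (hz i)) (hz1 i) (by norm_num)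
      have h2 : |M| ≤ |M| / L * ∏ i, |z i| ^ (-(3 / 5) : ℝ) := by
        rw [div_mul_eq_mul_div, le_div_iff₀ hL0]
        exact mul_le_mul_of_nonneg_left h1 (abs_nonneg _)
      linarith [hM z h, le_abs_self M]

/-- The parabolic dilation `(t, x) ↦ (ε² t, ε x)`. -/
def parDilate (ε : ℝ) (z : Fin 4 → ℝ) : Fin 4 → ℝ :=
  fun i => if i = 0 then ε ^ 2 * z 0 else ε * z i

lemma parDilate_sub (ε : ℝ) (z w : Fin 4 → ℝ) :
    parDilate ε (z - w) = parDilate ε z - parDilate ε w := by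
  funext i
  simp only [parDilate, Pi.sub_apply]
  split_ifs <;> ring

lemma continuous_parDilate (ε : ℝ) : Continuous (parDilate ε) := by
  refine continuous_pi fun i => ?_
  unfold parDilate
  split_ifs <;> fun_prop

lemma pnorm_parDilate {ε : ℝ} (hε : 0 < ε) (z : Fin 4 → ℝ) :
    pnorm (parDilate ε z) = ε * pnorm z := by
  have h1 : |ε ^ 2 * z 0| = ε ^ 2 * |z 0| := by rw [abs_mul, abs_of_pos (by positivity)]
  have h2 : (ε * z 1) ^ 2 + (ε * z 2) ^ 2 + (ε * z 3) ^ 2 =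
      ε ^ 2 * (z 1 ^ 2 + z 2 ^ 2 + z 3 ^ 2) := by ring
  simp only [pnorm, parDilate, if_true, Fin.reduceEq, if_false, h1, h2]
  rw [Real.sqrt_mul (by positivity), Real.sqrt_mul (by positivity), Real.sqrt_sq hε.le, mul_add]

lemma heatP_parDilate {ε : ℝ} (hε : 0 < ε) (z : Fin 4 → ℝ) :
    ε ^ 3 * heatP (parDilate ε z) = heatP z := by
  have h0 : 0 < ε ^ 2 * z 0 ↔ 0 < z 0 := by
    constructor
    · exact fun h => pos_of_mul_pos_right h (by positivity)
    · intro h; positivity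
  simp only [heatP, parDilate, if_true, h0, Fin.reduceEq, if_false]
  split_ifs with ht
  · have h1 : (4 * Real.pi * (ε ^ 2 * z 0)) ^ (-(3 : ℝ) / 2) =
        (ε ^ 3)⁻¹ * (4 * Real.pi * z 0) ^ (-(3 : ℝ) / 2) := by
      rw [show 4 * Real.pi * (ε ^ 2 * z 0) = ε ^ 2 * (4 * Real.pi * z 0) by ring,
        Real.mul_rpow (by positivity) (by positivity), ← Real.rpow_natCast ε 2,
        ← Real.rpow_mul hε.le, ← Real.rpow_natCast ε 3, ← Real.rpow_neg hε.le]
      norm_num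
    have h2 : -((ε * z 1) ^ 2 + (ε * z 2) ^ 2 + (ε * z 3) ^ 2) / (4 * (ε ^ 2 * z 0)) =
        -(z 1 ^ 2 + z 2 ^ 2 + z 3 ^ 2) / (4 * z 0) := by
      field_simp
    rw [h1, h2]
    field_simp
  · simp

lemma HasHyperbolicBound.parDilate {C ε : ℝ} {f : (Fin 4 → ℝ) → ℝ} (hf : HasHyperbolicBound C f)
    (hε : 0 < ε) : HasHyperbolicBound C fun z => ε ^ 3 * f (parDilate ε z) := by
  intro z hz
  have h1 : ∀ i, _root_.parDilate ε z i ≠ 0 := by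
    intro i
    unfold _root_.parDilate
    split_ifs
    · exact mul_ne_zero (by positivity) (hz 0)
    · exact mul_ne_zero hε.ne' (hz i)
  have h2 := hf _ h1
  have h3 : ε ^ 3 * ∏ i, |_root_.parDilate ε z i| ^ (-(3 / 5) : ℝ) =
      ∏ i, |z i| ^ (-(3 / 5) : ℝ) := by
    have h4 : ε ^ 3 * ((ε ^ 2) ^ (-(3 / 5) : ℝ) * ε ^ (-(3 / 5) : ℝ) * ε ^ (-(3 / 5) : ℝ) *
        ε ^ (-(3 / 5) : ℝ)) = 1 := by
      rw [← Real.rpow_natCast ε 2, ← Real.rpow_natCast ε 3, ← Real.rpow_mul hε.le,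
        ← Real.rpow_add hε, ← Real.rpow_add hε, ← Real.rpow_add hε, ← Real.rpow_add hε]
      norm_num
    simp only [Fin.prod_univ_four, _root_.parDilate, if_true, Fin.reduceEq, if_false, abs_mul,
      abs_of_pos hε, abs_pow]
    simp only [Real.mul_rpow (pow_nonneg hε.le 2) (abs_nonneg (z 0)),
      Real.mul_rpow hε.le (abs_nonneg _)]
    linear_combination (|z 0| ^ (-(3 / 5) : ℝ) * |z 1| ^ (-(3 / 5) : ℝ) *
      |z 2| ^ (-(3 / 5) : ℝ) * |z 3| ^ (-(3 / 5) : ℝ)) * h4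
  rw [abs_mul, abs_of_pos (by positivity), ← h3]
  calc _ ≤ _ := mul_le_mul_of_nonneg_left h2 (by positivity)
    _ = _ := by ring

lemma integral_comp_parDilate {ε : ℝ} (hε : 0 < ε) (f : (Fin 4 → ℝ) → ℝ) :
    ∫ z, f z = ε ^ 5 * ∫ z, f (parDilate ε z) := by
  set D : Fin 4 → ℝ := ![ε ^ 2, ε, ε, ε] with hD
  have hdet : (Matrix.diagonal D).det = ε ^ 5 := by
    rw [Matrix.det_diagonal, Fin.prod_univ_four]
    simp only [hD, Matrix.cons_val]
    ring
  have hfun : ⇑(Matrix.toLin' (Matrix.diagonal D)) = parDilate ε := by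
    funext z i
    rw [Matrix.toLin'_apply, Matrix.mulVec_diagonal]
    fin_cases i <;> simp [hD, parDilate]
  have hne : (Matrix.diagonal D).det ≠ 0 := by rw [hdet]; positivity
  have h := Real.smul_map_diagonal_volume_pi hne
  rw [hdet, abs_of_pos (by positivity), hfun] at h
  have hemb : MeasurableEmbedding (parDilate ε) := by
    refine (continuous_parDilate ε).measurableEmbedding fun z w hzw => ?_
    funext i
    have := congrFun hzw i
    unfold parDilate at this
    split_ifs at this with hi
    · subst hi
      exact mul_left_cancel₀ (by positivity) this
    · exact mul_left_cancel₀ hε.ne' this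
  conv_lhs => rw [← h]
  rw [integral_smul_measure, hemb.integral_map, ENNReal.toReal_ofReal (by positivity), smul_eq_mul]

lemma parRescale_parDilate {ε : ℝ} (hε : 0 < ε) (φ : (Fin 4 → ℝ) → ℝ) (z : Fin 4 → ℝ) :
    parRescale ε φ (parDilate ε z) = (ε ^ 5)⁻¹ * φ z := by
  unfold parRescale parDilate
  congr 2
  funext i
  by_cases hi : i = 0
  · subst hi
    simp only [if_true]
    field_simp
  · simp only [hi, if_false]
    field_simp

lemma stConv_parRescale {ε : ℝ} (hε : 0 < ε) (K ρ : (Fin 4 → ℝ) → ℝ) (z : Fin 4 → ℝ) :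
    ε ^ 3 * stConv K (parRescale ε ρ) (parDilate ε z) =
      stConv (fun z => ε ^ 3 * K (parDilate ε z)) ρ z := by
  unfold stConv
  rw [integral_comp_parDilate hε, ← integral_const_mul, ← integral_const_mul]
  refine integral_congr_ae (ae_of_all _ fun w => ?_)
  simp only [parRescale_parDilate hε, parDilate_sub]
  field_simp

lemma mul_integral_sq_stConv_parRescale {ε : ℝ} (hε : 0 < ε) (K ρ : (Fin 4 → ℝ) → ℝ) :
    ε * ∫ z, (stConv K (parRescale ε ρ) z) ^ 2 =
      ∫ z, (stConv (fun z => ε ^ 3 * K (parDilate ε z)) ρ z) ^ 2 := by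
  rw [integral_comp_parDilate hε, ← mul_assoc, ← integral_const_mul]
  refine integral_congr_ae (ae_of_all _ fun z => ?_)
  simp only [← stConv_parRescale hε]
  ring

lemma eventually_rescaled_kernel_eq_heatP {K : (Fin 4 → ℝ) → ℝ}
    (hK_eq : ∀ z : Fin 4 → ℝ, 0 < pnorm z → pnorm z ≤ 1 / 2 → K z = heatP z)
    {z : Fin 4 → ℝ} (hz : 0 < pnorm z) :
    ∀ᶠ ε in 𝓝[>] (0 : ℝ), ε ^ 3 * K (parDilate ε z) = heatP z := by
  have h : Ioo (0 : ℝ) (1 / (2 * pnorm z)) ∈ 𝓝[>] (0 : ℝ) := Ioo_mem_nhdsGT (by positivity)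
  filter_upwards [h] with ε hε
  rw [hK_eq, heatP_parDilate hε.1]
  · rw [pnorm_parDilate hε.1]; exact mul_pos hε.1 hz
  · rw [pnorm_parDilate hε.1]
    have := (lt_div_iff₀ (by positivity)).1 hε.2
    linarith

/-- The constant `C₀ = ∫ (P*ρ)² dz` is finite and
`ε·∫ (K*ρ_ε)²(z) dz → C₀` as `ε → 0⁺`; i.e. `C₁^{(ε)} = ∫ K_ε² = C₀/ε + O(1)`. -/
theorem stmt_13 (ρ K : (Fin 4 → ℝ) → ℝ)
    (hρ_smooth : ContDiff ℝ (⊤ : ℕ∞) ρ) (hρ_supp : HasCompactSupport ρ)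
    (hρ_int : ∫ z, ρ z = 1)
    (hK_meas : Measurable K) (hK_supp : HasCompactSupport K)
    (hK_eq : ∀ z : Fin 4 → ℝ, 0 < pnorm z → pnorm z ≤ 1 / 2 → K z = heatP z)
    (hK_bdd : ∃ M : ℝ, ∀ z : Fin 4 → ℝ, 1 / 2 ≤ pnorm z → |K z| ≤ M) :
    Integrable (fun z : Fin 4 → ℝ => (stConv heatP ρ z) ^ 2) ∧
    Filter.Tendsto
      (fun ε : ℝ => ε * ∫ z : Fin 4 → ℝ, (stConv K (parRescale ε ρ) z) ^ 2)
      (nhdsWithin 0 (Set.Ioi 0))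
      (nhds (∫ z : Fin 4 → ℝ, (stConv heatP ρ z) ^ 2)) := by
  have hρ_cont : Continuous ρ := hρ_smooth.continuous
  obtain ⟨A, R, hR1, hA, hR⟩ := exists_abs_le_cutoff hρ_cont hρ_supp
  obtain ⟨B, hB⟩ := exists_integral_cutProfile_le hR1
  obtain ⟨C, hC, hCK⟩ := exists_hasHyperbolicBound hK_supp hK_eq hK_bdd
  have hmeas : ∀ ε, Measurable fun z => ε ^ 3 * K (parDilate ε z) := fun ε =>
    (hK_meas.comp (continuous_parDilate ε).measurable).const_mul _
  have sq_bound : ∀ {f : (Fin 4 → ℝ) → ℝ} {C' : ℝ}, HasHyperbolicBound C' f → 0 ≤ C' → ∀ z,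
      ‖(stConv f ρ z) ^ 2‖ ≤ (C' * A * ∏ i, B * (1 + |z i|) ^ (-(3 / 5) : ℝ)) ^ 2 := by
    intro f C' hf hC' z
    rw [norm_pow, Real.norm_eq_abs]
    exact pow_le_pow_left₀ (abs_nonneg _) (hf.abs_stConv_le hC' hA hR1 hR hB z) 2
  refine ⟨(integrable_sq_prod_one_add_abs (64 * A) B).mono'
    ((measurable_stConv measurable_heatP hρ_cont.measurable).pow_const 2).aestronglyMeasurable
    (ae_of_all _ (sq_bound hasHyperbolicBound_heatP (by norm_num))), ?_⟩
  have hpos : ∀ᶠ ε in 𝓝[>] (0 : ℝ), 0 < ε := self_mem_nhdsWithin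
  refine Tendsto.congr' (f₁ := fun ε : ℝ =>
    ∫ z, (stConv (fun z => ε ^ 3 * K (parDilate ε z)) ρ z) ^ 2) ?_ ?_
  · filter_upwards [hpos] with ε hε
    exact (mul_integral_sq_stConv_parRescale hε K ρ).symm
  refine tendsto_integral_filter_of_dominated_convergence _ ?_ ?_
    (integrable_sq_prod_one_add_abs (C * A) B) ?_
  · exact Eventually.of_forall fun ε =>
      ((measurable_stConv (hmeas ε) hρ_cont.measurable).pow_const 2).aestronglyMeasurable
  · filter_upwards [hpos] with ε hε
    exact ae_of_all _ (sq_bound (hCK.parDilate hε) hC)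
  · refine ae_of_all _ fun z => Tendsto.pow ?_ 2
    refine tendsto_integral_filter_of_dominated_convergence
      (fun v => C * A * ∏ i, cutProfile R (z i) (v i)) ?_ ?_
      ((integrable_prod_cutProfile hR1 z).const_mul _) ?_
    · exact Eventually.of_forall fun ε => (((hmeas ε).comp (measurable_const.sub measurable_id)).mul
        hρ_cont.measurable).aestronglyMeasurable
    · filter_upwards [hpos] with ε hε
      exact (hCK.parDilate hε).ae_norm_mul_le hA hR z
    · filter_upwards [ae_forall_apply_ne z] with v hv
      refine tendsto_nhds_of_eventually_eq ?_
      filter_upwards [eventually_rescaled_kernel_eq_heatP hK_eq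
        (pnorm_pos_of_apply_zero_ne (hv 0))] with ε hε
      rw [hε]
end
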